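/- arXiv:2404.06342 — 6 statements merged into one kernel-verified Lean document; each statement's English description precedes it below -/
import Mathlib

section
/- Let n, m be positive integers, let Φ : ℝⁿ → ℝᵐ be continuous, let R : ℝⁿ → ℝ be nonnegative, convex and continuous, let K ⊆ ℝⁿ be a nonempty compact set, and let λ, ρ > 0. For Λ ∈ ℝᵐ write 𝒥[Λ](σ) = (1/2)‖Φ(σ) − Λ‖² + (λρ/2)‖σ‖² + λ R(σ). Suppose Λ_k → Λ in ℝᵐ, that for each k the point σ_k ∈ K is a minimizer of 𝒥[Λ_k] over K, and that a subsequence (σ_{k_j}) converges to σ̄ ∈ K. Then σ̄ is a minimizer of 𝒥[Λ] over K. -/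
open Filter Topology in
/-- If `f` is jointly continuous, a limit of minimizers of `f (a i)` over `K` minimizes the
limiting function over `K`. -/
theorem isMinOn_of_tendsto_of_isMinOn {ι X Y Z : Type*} [TopologicalSpace X] [TopologicalSpace Y]
    [TopologicalSpace Z] [Preorder Z] [OrderClosedTopology Z] {l : Filter ι} [l.NeBot]
    {f : X → Y → Z} (hf : Continuous fun p : X × Y => f p.1 p.2) {K : Set Y}
    {a : ι → X} {b : ι → Y} {x : X} {y : Y} (ha : Tendsto a l (𝓝 x)) (hb : Tendsto b l (𝓝 y))
    (hmin : ∀ i, IsMinOn (f (a i)) K (b i)) : IsMinOn (f x) K y := by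
  rw [isMinOn_iff]
  intro z hz
  exact le_of_tendsto_of_tendsto' ((hf.tendsto (x, y)).comp (ha.prodMk_nhds hb))
    ((hf.tendsto (x, z)).comp (ha.prodMk_nhds tendsto_const_nhds))
    fun i => isMinOn_iff.1 (hmin i) z hz

/-- Stability of minimizers of the regularized functional with respect to perturbations
of the datum: limits of (subsequences of) minimizers for perturbed data are minimizers
for the limit datum. -/
theorem stmt_1 (n m : ℕ) (hn : 0 < n) (hm : 0 < m)
    (Φ : EuclideanSpace ℝ (Fin n) → EuclideanSpace ℝ (Fin m)) (hΦ : Continuous Φ)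
    (R : EuclideanSpace ℝ (Fin n) → ℝ) (hR0 : ∀ σ, 0 ≤ R σ)
    (hRconv : ConvexOn ℝ Set.univ R) (hRcont : Continuous R)
    (K : Set (EuclideanSpace ℝ (Fin n))) (hKcomp : IsCompact K) (hKne : K.Nonempty)
    (lam ρ : ℝ) (hlam : 0 < lam) (hρ : 0 < ρ)
    (J : EuclideanSpace ℝ (Fin m) → EuclideanSpace ℝ (Fin n) → ℝ)
    (hJ : ∀ Λ' σ, J Λ' σ = (1/2) * ‖Φ σ - Λ'‖^2 + (lam * ρ / 2) * ‖σ‖^2 + lam * R σ)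
    (Λ : EuclideanSpace ℝ (Fin m)) (Λseq : ℕ → EuclideanSpace ℝ (Fin m))
    (hΛconv : Filter.Tendsto Λseq Filter.atTop (nhds Λ))
    (σseq : ℕ → EuclideanSpace ℝ (Fin n)) (hσK : ∀ k, σseq k ∈ K)
    (hσmin : ∀ k, ∀ σ ∈ K, J (Λseq k) (σseq k) ≤ J (Λseq k) σ)
    (σbar : EuclideanSpace ℝ (Fin n)) (hσbar : σbar ∈ K)
    (φ : ℕ → ℕ) (hφ : StrictMono φ)
    (hconv : Filter.Tendsto (σseq ∘ φ) Filter.atTop (nhds σbar)) :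
    ∀ σ ∈ K, J Λ σbar ≤ J Λ σ := by
  have hJcont : Continuous fun p : EuclideanSpace ℝ (Fin m) × EuclideanSpace ℝ (Fin n) =>
      J p.1 p.2 := by
    simp only [hJ]
    fun_prop
  exact isMinOn_iff.1 <| isMinOn_of_tendsto_of_isMinOn hJcont
    (hΛconv.comp hφ.tendsto_atTop) hconv fun j => isMinOn_iff.2 (hσmin (φ j))
end

section
/- Let n, m be positive integers, let 0 < c0 < c1, let K01 = [c0,c1]^n, and let K ⊆ K01 be a nonempty compact convex set. Let Φ : ℝⁿ → ℝᵐ be differentiable with Jacobian J_Φ(σ) at σ, let R : ℝⁿ → ℝ be nonnegative, convex and continuous, let λ, ρ, μ > 0, and Λ ∈ ℝᵐ. Define 𝒥(σ) = (1/2)‖Φ(σ) − Λ‖² + (λρ/2)‖σ‖² + λ R(σ). Assume: (i) RIP: there are 0 < α ≤ β with α‖σ1 − σ2‖² ≤ ‖J_Φ(σ)(σ1 − σ2)‖² ≤ β‖σ1 − σ2‖² for all σ ∈ K01 and all σ1, σ2 ∈ ℝⁿ; (ii) mild nonlinearity: there is γ > 0 with ‖Φ(σ1) − Φ(σ2) −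 J_Φ(σ2)(σ1 − σ2)‖² ≤ γ‖σ1 − σ2‖² for all σ1, σ2 ∈ K01; (iii) μ ≤ 1/(2β) and μ ≤ 1/(2λρ). Let σⁿ ∈ K and let σⁿ⁺¹ ∈ K minimize over K the function σ ↦ (1/2)‖σ − (σⁿ − μλρ σⁿ + μ J_Φ(σⁿ)ᵀ(Λ − Φ(σⁿ)))‖² + μλ R(σ). Then for every σ ∈ K, ‖σⁿ⁺¹ − σ‖² ≤ (1 − μλρ − μα + 2μγ)‖σⁿ − σ‖² + 4μ 𝒥(σ). -/
open scoped RealInnerProductSpace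

lemma nonneg_of_forall_add_mul_nonneg {A B : ℝ} (hB : 0 ≤ B)
    (h : ∀ t : ℝ, 0 < t → t ≤ 1 → 0 ≤ A + t * B) : 0 ≤ A := by
  by_contra! hA
  have hD : 0 < -A + B + 1 := by linarith
  have h1 := h (-A / (-A + B + 1)) (div_pos (by linarith) hD)
    ((div_le_one hD).2 (by linarith))
  have h2 : A + -A / (-A + B + 1) * B = A * (1 - A) / (-A + B + 1) := by
    field_simp
    ring
  rw [h2] at h1
  exact absurd h1 (not_le.2 (div_neg_of_neg_of_pos (by nlinarith) hD))

/-- A minimizer of `q ↦ ‖q - z‖² / 2 + g q` over a convex set, with `g` convex, satisfies the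
quadratic growth inequality given by strong convexity. -/
lemma ConvexOn.prox_quadratic_growth {E : Type*} [NormedAddCommGroup E] [InnerProductSpace ℝ E]
    {K : Set E} {g : E → ℝ} (hg : ConvexOn ℝ K g) {z p : E} (hp : p ∈ K)
    (hmin : ∀ q ∈ K, (1/2) * ‖p - z‖^2 + g p ≤ (1/2) * ‖q - z‖^2 + g q) {q : E} (hq : q ∈ K) :
    (1/2) * ‖p - z‖^2 + g p + (1/2) * ‖p - q‖^2 ≤ (1/2) * ‖q - z‖^2 + g q := by
  have key : 0 ≤ ⟪p - z, q - p⟫ + (g q - g p) := by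
    refine nonneg_of_forall_add_mul_nonneg (B := (1/2) * ‖q - p‖^2) (by positivity) ?_
    intro t ht ht1
    have h1 := hmin _ (hg.1 hp hq (sub_nonneg.2 ht1) ht.le (by ring))
    have h2 := hg.2 hp hq (sub_nonneg.2 ht1) ht.le (by ring)
    have h3 : (1 - t) • p + t • q - z = (p - z) + t • (q - p) := by module
    rw [h3, norm_add_sq_real, inner_smul_right, norm_smul, mul_pow, Real.norm_eq_abs,
      sq_abs] at h1
    simp only [smul_eq_mul] at h2
    refine nonneg_of_mul_nonneg_right (a := t) ?_ ht
    nlinarith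
  have h4 : q - z = (p - z) + (q - p) := by abel
  rw [h4, norm_add_sq_real, norm_sub_rev p q]
  linarith

/-- One-step estimate (eq. 23) for the proximal-gradient method in the proof of
Theorem 4.2 of the paper. -/
theorem stmt_7 (n m : ℕ) (hn : 0 < n) (hm : 0 < m) (c0 c1 : ℝ) (hc0 : 0 < c0) (hc1 : c0 < c1)
    (K01 : Set (EuclideanSpace ℝ (Fin n)))
    (hK01 : K01 = {σ : EuclideanSpace ℝ (Fin n) | ∀ i, σ i ∈ Set.Icc c0 c1})
    (K : Set (EuclideanSpace ℝ (Fin n))) (hKcomp : IsCompact K) (hKconv : Convex ℝ K)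
    (hKne : K.Nonempty) (hKsub : K ⊆ K01)
    (Φ : EuclideanSpace ℝ (Fin n) → EuclideanSpace ℝ (Fin m))
    (J : EuclideanSpace ℝ (Fin n) → (EuclideanSpace ℝ (Fin n) →L[ℝ] EuclideanSpace ℝ (Fin m)))
    (hJ : ∀ σ, HasFDerivAt Φ (J σ) σ)
    (R : EuclideanSpace ℝ (Fin n) → ℝ) (hR0 : ∀ σ, 0 ≤ R σ)
    (hRconv : ConvexOn ℝ Set.univ R) (hRcont : Continuous R)
    (lam ρ μ : ℝ) (hlam : 0 < lam) (hρ : 0 < ρ) (hμ : 0 < μ)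
    (Λ : EuclideanSpace ℝ (Fin m))
    -- (i) RIP
    (α β : ℝ) (hα : 0 < α) (hαβ : α ≤ β)
    (hRIPlow : ∀ σ ∈ K01, ∀ σ1 σ2 : EuclideanSpace ℝ (Fin n),
      α * ‖σ1 - σ2‖^2 ≤ ‖J σ (σ1 - σ2)‖^2)
    (hRIPup : ∀ σ ∈ K01, ∀ σ1 σ2 : EuclideanSpace ℝ (Fin n),
      ‖J σ (σ1 - σ2)‖^2 ≤ β * ‖σ1 - σ2‖^2)
    -- (ii) mild nonlinearity
    (γ : ℝ) (hγ : 0 < γ)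
    (hmild : ∀ σ1 ∈ K01, ∀ σ2 ∈ K01,
      ‖Φ σ1 - Φ σ2 - J σ2 (σ1 - σ2)‖^2 ≤ γ * ‖σ1 - σ2‖^2)
    -- (iii) step-size restrictions
    (hμβ : μ ≤ 1 / (2 * β)) (hμlamρ : μ ≤ 1 / (2 * lam * ρ))
    -- the proximal-gradient step
    (σn σn1 : EuclideanSpace ℝ (Fin n)) (hσn : σn ∈ K) (hσn1 : σn1 ∈ K)
    (hprox : ∀ σ ∈ K,
      (1/2) * ‖σn1 - (σn - (μ * lam * ρ) • σn +
          μ • (ContinuousLinearMap.adjoint (J σn) (Λ - Φ σn)))‖^2 + μ * lam * R σn1 ≤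
      (1/2) * ‖σ - (σn - (μ * lam * ρ) • σn +
          μ • (ContinuousLinearMap.adjoint (J σn) (Λ - Φ σn)))‖^2 + μ * lam * R σ) :
    ∀ σ ∈ K,
      ‖σn1 - σ‖^2 ≤ (1 - μ * lam * ρ - μ * α + 2 * μ * γ) * ‖σn - σ‖^2 +
        4 * μ * ((1/2) * ‖Φ σ - Λ‖^2 + (lam * ρ / 2) * ‖σ‖^2 + lam * R σ) := by
  intro σ hσ
  have hβ : 0 < β := hα.trans_le hαβ
  have hμβ' : μ * β ≤ 1 / 2 := by
    rw [le_div_iff₀ (by positivity)] at hμβ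
    linarith
  have hμlamρ' : μ * lam * ρ ≤ 1 / 2 := by
    rw [le_div_iff₀ (by positivity)] at hμlamρ
    linarith
  have hconv : ConvexOn ℝ K fun q => μ * lam * R q :=
    (hRconv.subset (Set.subset_univ K) hKconv).smul (mul_pos hμ hlam).le
  have hgrow := hconv.prox_quadratic_growth hσn1 hprox hσ
  have hlow := hRIPlow σn (hKsub hσn) σn σ
  have hup := hRIPup σn (hKsub hσn) σn1 σn
  have hlin := hmild σ (hKsub hσ) σn (hKsub hσn)
  have hRσ := mul_nonneg (mul_pos hμ hlam).le (hR0 σ)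
  have hRσn1 := mul_nonneg (mul_pos hμ hlam).le (hR0 σn1)
  set b := σn - σ with hb
  set d := σn1 - σn with hd
  set r := Φ σn - Λ with hr
  set s := Φ σ - Λ with hs
  set v := μ • ContinuousLinearMap.adjoint (J σn) (Λ - Φ σn) - (μ * lam * ρ) • σn with hv
  have e1 : σn1 - (σn - (μ * lam * ρ) • σn +
      μ • (ContinuousLinearMap.adjoint (J σn) (Λ - Φ σn))) = d - v := by
    rw [hd, hv]; abel
  have e2 : σ - (σn - (μ * lam * ρ) • σn +
      μ • (ContinuousLinearMap.adjoint (J σn) (Λ - Φ σn))) = -(b + v) := by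
    rw [hb, hv]; abel
  rw [e1, e2, norm_neg, norm_sub_sq_real, norm_add_sq_real] at hgrow
  have hinner (w : EuclideanSpace ℝ (Fin n)) :
      ⟪w, v⟫ = -(μ * ⟪J σn w, r⟫) - μ * lam * ρ * ⟪w, σn⟫ := by
    rw [hv, inner_sub_right, inner_smul_right, inner_smul_right,
      ContinuousLinearMap.adjoint_inner_right, ← neg_sub (Φ σn) Λ, inner_neg_right]
    ring
  rw [hinner, hinner] at hgrow
  have e3 : Φ σ - Φ σn - J σn (σ - σn) = s + (J σn b - r) := by
    rw [← neg_sub σn σ, map_neg]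
    simp only [hs, hr, hb]
    abel
  rw [e3, norm_sub_rev σ σn] at hlin
  have hres : ‖J σn b - r‖^2 ≤ 2 * (γ * ‖b‖^2) + 2 * ‖s‖^2 := by
    have hpar := parallelogram_law_with_norm ℝ (s + (J σn b - r)) s
    rw [add_sub_cancel_left] at hpar
    nlinarith [sq_nonneg ‖s + (J σn b - r) + s‖]
  rw [norm_sub_sq_real] at hres
  have hJd : 0 ≤ ‖J σn d‖^2 + 2 * ⟪J σn d, r⟫ + ‖r‖^2 := by
    rw [← norm_add_sq_real]; positivity
  have hdσ : 0 ≤ ‖d‖^2 + 2 * ⟪d, σn⟫ + ‖σn‖^2 := by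
    rw [← norm_add_sq_real]; positivity
  have hσsq : ‖σ‖^2 = ‖σn‖^2 - 2 * ⟪b, σn⟫ + ‖b‖^2 := by
    rw [real_inner_comm, ← norm_sub_sq_real, hb, sub_sub_cancel]
  have hκ : 0 < μ * lam * ρ := by positivity
  have t1 : μ * (‖J σn b‖^2 - 2 * ⟪J σn b, r⟫ + ‖r‖^2)
      ≤ μ * (2 * (γ * ‖b‖^2) + 2 * ‖s‖^2) := mul_le_mul_of_nonneg_left hres hμ.le
  have t2 := mul_le_mul_of_nonneg_left hlow hμ.le
  have t3 := mul_le_mul_of_nonneg_left hup hμ.le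
  have t4 := mul_le_mul_of_nonneg_right hμβ' (sq_nonneg ‖d‖)
  have t5 := mul_le_mul_of_nonneg_right hμlamρ' (sq_nonneg ‖d‖)
  have t6 := mul_nonneg hμ.le hJd
  have t7 := mul_nonneg hκ.le hdσ
  have t8 := congrArg (fun x => μ * lam * ρ * x) hσsq
  have t9 := mul_nonneg hκ.le (sq_nonneg ‖σ‖)
  linarith
end

section
/- Let n, m be positive integers, let 0 < c0 < c1, let K01 = [c0,c1]^n, and let K ⊆ K01 be a nonempty compact convex set. Let Φ : ℝⁿ → ℝᵐ be differentiable with Jacobian J_Φ(σ), let R : ℝⁿ → ℝ be nonnegative, convex and continuous, let λ, ρ, μ > 0, and Λ ∈ ℝᵐ. Define 𝒥(σ) = (1/2)‖Φ(σ) − Λ‖² + (λρ/2)‖σ‖² + λ R(σ). Assume: (i) RIP with constants 0 < α ≤ β: α‖σ1 − σ2‖² ≤ ‖J_Φ(σ)(σ1 − σ2)‖² ≤ β‖σ1 − σ2‖² for all σ ∈ K01 and all σ1, σ2 ∈ ℝⁿ; (ii) mild nonlinearity with constant γ > 0: ‖Φ(σ1) − Φ(σ2) − J_Φ(σ2)(σ1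 − σ2)‖² ≤ γ‖σ1 − σ2‖² for all σ1, σ2 ∈ K01; (iii) μ ≤ 1/(2β), μ ≤ 1/(2λρ), and α + λρ − 2γ > 0. Let σ⁰ ∈ K and for each n let σⁿ⁺¹ ∈ K minimize over K the function σ ↦ (1/2)‖σ − (σⁿ − μλρ σⁿ + μ J_Φ(σⁿ)ᵀ(Λ − Φ(σⁿ)))‖² + μλ R(σ). Set q = 1 − μλρ − μα + 2μγ. Then 0 ≤ q < 1 and for every σ ∈ K and every n ≥ 0, ‖σⁿ − σ‖² ≤ qⁿ ‖σ⁰ − σ‖² + (4/(α + λρ − 2γ)) 𝒥(σ). -/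
open scoped RealInnerProductSpace

lemma nonneg_of_forall_add_mul_nonneg_s8 {a b : ℝ} (hb : 0 ≤ b)
    (h : ∀ t : ℝ, 0 < t → t ≤ 1 → 0 ≤ a + t * b) : 0 ≤ a := by
  by_contra! ha
  have hba : 0 < b - a := by linarith
  have h1 := h (-a / (b - a)) (div_pos (by linarith) hba) ((div_le_one hba).2 (by linarith))
  have h2 : a + -a / (b - a) * b = -(a ^ 2 / (b - a)) := by
    field_simp
    ring
  have h3 : 0 < a ^ 2 / (b - a) := div_pos (by nlinarith) hba
  linarith

/-- The three-point inequality for a minimizer of a proximal objective over a convex set. -/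
lemma prox_three_point {E : Type*} [NormedAddCommGroup E] [InnerProductSpace ℝ E]
    {K : Set E} (hK : Convex ℝ K) {R : E → ℝ} (hR : ConvexOn ℝ Set.univ R) {c : ℝ} (hc : 0 ≤ c)
    {v y : E} (hy : y ∈ K)
    (hmin : ∀ z ∈ K, (1 / 2) * ‖y - v‖ ^ 2 + c * R y ≤ (1 / 2) * ‖z - v‖ ^ 2 + c * R z)
    {z : E} (hz : z ∈ K) :
    ‖y - v‖ ^ 2 + ‖z - y‖ ^ 2 + 2 * c * R y ≤ ‖z - v‖ ^ 2 + 2 * c * R z := by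
  have key : 0 ≤ ⟪y - v, z - y⟫ + c * (R z - R y) := by
    refine nonneg_of_forall_add_mul_nonneg_s8 (b := ‖z - y‖ ^ 2 / 2) (by positivity) fun t ht ht1 ↦ ?_
    have hmem : (1 - t) • y + t • z ∈ K := hK hy hz (by linarith) ht.le (by ring)
    have h1 := hmin _ hmem
    have h2 := hR.2 (Set.mem_univ y) (Set.mem_univ z) (by linarith : 0 ≤ 1 - t) ht.le (by ring)
    simp only [smul_eq_mul] at h2
    have h3 := mul_le_mul_of_nonneg_left h2 hc
    have h4 : (1 - t) • y + t • z - v = (y - v) + t • (z - y) := by module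
    rw [h4, norm_add_sq_real, inner_smul_right, norm_smul, Real.norm_of_nonneg ht.le] at h1
    refine nonneg_of_mul_nonneg_right (a := t) ?_ ht
    nlinarith
  have h5 : z - v = (y - v) + (z - y) := by abel
  rw [h5, norm_add_sq_real]
  linarith

/-- One step of the proximal-gradient method for the regularized least-squares functional. -/
lemma prox_gradient_step {E F : Type*} [NormedAddCommGroup E] [InnerProductSpace ℝ E]
    [CompleteSpace E] [NormedAddCommGroup F] [InnerProductSpace ℝ F] [CompleteSpace F]
    {K : Set E} (hK : Convex ℝ K) {R : E → ℝ} (hR : ConvexOn ℝ Set.univ R) (hR0 : ∀ x, 0 ≤ R x)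
    {A : E →L[ℝ] F} {Φx Φz Λ : F} {x y z : E} {lam s μ α β γ : ℝ} (hlam : 0 ≤ lam) (hs : 0 ≤ s)
    (hμ : 0 ≤ μ) (hμs : μ * s ≤ 1 / 2) (hμβ : μ * β ≤ 1 / 2) (hy : y ∈ K) (hz : z ∈ K)
    (hlow : α * ‖z - x‖ ^ 2 ≤ ‖A (z - x)‖ ^ 2) (hup : ‖A (x - y)‖ ^ 2 ≤ β * ‖x - y‖ ^ 2)
    (hmild : ‖Φz - Φx - A (z - x)‖ ^ 2 ≤ γ * ‖z - x‖ ^ 2)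
    (hmin : ∀ w ∈ K,
      (1 / 2) * ‖y - (x - (μ * s) • x + μ • A.adjoint (Λ - Φx))‖ ^ 2 + μ * lam * R y ≤
      (1 / 2) * ‖w - (x - (μ * s) • x + μ • A.adjoint (Λ - Φx))‖ ^ 2 + μ * lam * R w) :
    ‖y - z‖ ^ 2 ≤ (1 - μ * s - μ * α + 2 * μ * γ) * ‖x - z‖ ^ 2 +
      4 * μ * ((1 / 2) * ‖Φz - Λ‖ ^ 2 + (s / 2) * ‖z‖ ^ 2 + lam * R z) := by
  have h3 := prox_three_point hK hR (mul_nonneg hμ hlam) hy hmin hz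
  set r := Λ - Φx with hr
  set g := s • x - A.adjoint r with hg
  have hexp : ∀ w, ‖w - (x - (μ * s) • x + μ • A.adjoint r)‖ ^ 2 =
      ‖w - x‖ ^ 2 + 2 * (μ * (s * ⟪x, w - x⟫ - ⟪r, A (w - x)⟫)) + ‖μ • g‖ ^ 2 := by
    intro w
    have : w - (x - (μ * s) • x + μ • A.adjoint r) = (w - x) + μ • g := by
      rw [hg]; module
    rw [this, norm_add_sq_real, inner_smul_right, real_inner_comm, hg, inner_sub_left,
      inner_smul_left, ContinuousLinearMap.adjoint_inner_left]
    simp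
  rw [hexp, hexp] at h3
  have hzx : ‖z‖ ^ 2 = ‖x‖ ^ 2 + 2 * ⟪x, z - x⟫ + ‖z - x‖ ^ 2 := by
    rw [← norm_add_sq_real, add_sub_cancel]
  have hxy : 0 ≤ ‖x‖ ^ 2 + 2 * ⟪x, y - x⟫ + ‖y - x‖ ^ 2 := by
    rw [← norm_add_sq_real]; positivity
  have hry : 0 ≤ ‖r‖ ^ 2 - 2 * ⟪r, A (y - x)⟫ + ‖A (y - x)‖ ^ 2 := by
    rw [← norm_sub_sq_real]; positivity
  have hrz : ‖r - A (z - x)‖ ^ 2 = ‖r‖ ^ 2 - 2 * ⟪r, A (z - x)⟫ + ‖A (z - x)‖ ^ 2 :=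
    norm_sub_sq_real _ _
  have hpe : ‖r - A (z - x)‖ ^ 2 ≤ 2 * ‖Φz - Λ‖ ^ 2 + 2 * ‖Φz - Φx - A (z - x)‖ ^ 2 := by
    have : r - A (z - x) = (Φz - Φx - A (z - x)) - (Φz - Λ) := by rw [hr]; abel
    rw [this]
    have := parallelogram_law_with_norm ℝ (Φz - Φx - A (z - x)) (Φz - Λ)
    nlinarith [sq_nonneg ‖(Φz - Φx - A (z - x)) + (Φz - Λ)‖]
  have hup' : ‖A (y - x)‖ ^ 2 ≤ β * ‖y - x‖ ^ 2 := by
    rwa [← neg_sub x y, map_neg, norm_neg, norm_neg]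
  rw [norm_sub_rev y z, norm_sub_rev x z]
  have e1 := mul_nonneg (mul_nonneg hμ hs) hxy
  have e2 := mul_nonneg hμ hry
  have e3 := mul_le_mul_of_nonneg_left hup' hμ
  have e4 := mul_le_mul_of_nonneg_right hμs (sq_nonneg ‖y - x‖)
  have e5 := mul_le_mul_of_nonneg_right hμβ (sq_nonneg ‖y - x‖)
  have e6 := mul_le_mul_of_nonneg_left hlow hμ
  have e7 := mul_le_mul_of_nonneg_left hmild hμ
  have e8 := mul_le_mul_of_nonneg_left hpe hμ
  rw [hrz] at e8
  have e9 := mul_nonneg (mul_nonneg hμ hlam) (hR0 y)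
  have e10 := mul_nonneg (mul_nonneg hμ hlam) (hR0 z)
  have e11 := mul_nonneg (mul_nonneg hμ hs) (sq_nonneg ‖z‖)
  have e12 := congrArg (fun u ↦ μ * s * u) hzx
  linarith

/-- Iterating `a (k + 1) ≤ q * a k + b` and bounding the geometric series by its fixed point. -/
lemma le_pow_mul_add_of_contraction {a : ℕ → ℝ} {q b C : ℝ} (hq : 0 ≤ q) (hC : 0 ≤ C)
    (hfix : q * C + b = C) (h : ∀ k, a (k + 1) ≤ q * a k + b) (N : ℕ) :
    a N ≤ q ^ N * a 0 + C := by
  induction N with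
  | zero => simpa using hC
  | succ k ih =>
    have := mul_le_mul_of_nonneg_left ih hq
    rw [pow_succ]
    linarith [h k]


/-- Quantitative form of Theorem 4.2 of the paper: iterating the one-step estimate and
summing the geometric series yields, with q = 1 − μλρ − μα + 2μγ ∈ [0,1),
‖σⁿ − σ‖² ≤ qⁿ‖σ⁰ − σ‖² + (4/(α + λρ − 2γ)) 𝒥(σ) for every σ ∈ K. -/
theorem stmt_8 (n m : ℕ) (hn : 0 < n) (hm : 0 < m) (c0 c1 : ℝ) (hc0 : 0 < c0) (hc1 : c0 < c1)
    (K01 : Set (EuclideanSpace ℝ (Fin n)))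
    (hK01 : K01 = {σ : EuclideanSpace ℝ (Fin n) | ∀ i, σ i ∈ Set.Icc c0 c1})
    (K : Set (EuclideanSpace ℝ (Fin n))) (hKcomp : IsCompact K) (hKconv : Convex ℝ K)
    (hKne : K.Nonempty) (hKsub : K ⊆ K01)
    (Φ : EuclideanSpace ℝ (Fin n) → EuclideanSpace ℝ (Fin m))
    (J : EuclideanSpace ℝ (Fin n) → (EuclideanSpace ℝ (Fin n) →L[ℝ] EuclideanSpace ℝ (Fin m)))
    (hJ : ∀ σ, HasFDerivAt Φ (J σ) σ)
    (R : EuclideanSpace ℝ (Fin n) → ℝ) (hR0 : ∀ σ, 0 ≤ R σ)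
    (hRconv : ConvexOn ℝ Set.univ R) (hRcont : Continuous R)
    (lam ρ μ : ℝ) (hlam : 0 < lam) (hρ : 0 < ρ) (hμ : 0 < μ)
    (Λ : EuclideanSpace ℝ (Fin m))
    -- (i) RIP
    (α β : ℝ) (hα : 0 < α) (hαβ : α ≤ β)
    (hRIPlow : ∀ σ ∈ K01, ∀ σ1 σ2 : EuclideanSpace ℝ (Fin n),
      α * ‖σ1 - σ2‖^2 ≤ ‖J σ (σ1 - σ2)‖^2)
    (hRIPup : ∀ σ ∈ K01, ∀ σ1 σ2 : EuclideanSpace ℝ (Fin n),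
      ‖J σ (σ1 - σ2)‖^2 ≤ β * ‖σ1 - σ2‖^2)
    -- (ii) mild nonlinearity
    (γ : ℝ) (hγ : 0 < γ)
    (hmild : ∀ σ1 ∈ K01, ∀ σ2 ∈ K01,
      ‖Φ σ1 - Φ σ2 - J σ2 (σ1 - σ2)‖^2 ≤ γ * ‖σ1 - σ2‖^2)
    -- (iii) parameter restrictions
    (hμβ : μ ≤ 1 / (2 * β)) (hμlamρ : μ ≤ 1 / (2 * lam * ρ))
    (hpos : 0 < α + lam * ρ - 2 * γ)
    -- the proximal-gradient iterates
    (σseq : ℕ → EuclideanSpace ℝ (Fin n)) (hσ0 : σseq 0 ∈ K)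
    (hσmem : ∀ k : ℕ, σseq (k + 1) ∈ K)
    (hprox : ∀ k : ℕ, ∀ σ ∈ K,
      (1/2) * ‖σseq (k + 1) - (σseq k - (μ * lam * ρ) • σseq k +
          μ • (ContinuousLinearMap.adjoint (J (σseq k)) (Λ - Φ (σseq k))))‖^2
        + μ * lam * R (σseq (k + 1)) ≤
      (1/2) * ‖σ - (σseq k - (μ * lam * ρ) • σseq k +
          μ • (ContinuousLinearMap.adjoint (J (σseq k)) (Λ - Φ (σseq k))))‖^2
        + μ * lam * R σ) :
    (0 ≤ 1 - μ * lam * ρ - μ * α + 2 * μ * γ) ∧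
    (1 - μ * lam * ρ - μ * α + 2 * μ * γ < 1) ∧
    ∀ σ ∈ K, ∀ N : ℕ,
      ‖σseq N - σ‖^2 ≤ (1 - μ * lam * ρ - μ * α + 2 * μ * γ)^N * ‖σseq 0 - σ‖^2 +
        (4 / (α + lam * ρ - 2 * γ)) *
          ((1/2) * ‖Φ σ - Λ‖^2 + (lam * ρ / 2) * ‖σ‖^2 + lam * R σ) := by
  have hβ : 0 < β := hα.trans_le hαβ
  have hμβ' : μ * β ≤ 1 / 2 := by
    rw [le_div_iff₀ (by positivity)] at hμβ
    linarith
  have hμs : μ * (lam * ρ) ≤ 1 / 2 := by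
    rw [le_div_iff₀ (by positivity)] at hμlamρ
    linarith
  have hμα := mul_le_mul_of_nonneg_left hαβ hμ.le
  have hq0 : 0 ≤ 1 - μ * lam * ρ - μ * α + 2 * μ * γ := by
    linarith [mul_pos hμ hγ]
  refine ⟨hq0, by linarith [mul_pos hμ hpos], fun σ hσ N ↦ ?_⟩
  have hmem : ∀ k, σseq k ∈ K
    | 0 => hσ0
    | k + 1 => hσmem k
  have hRσ := hR0 σ
  refine le_pow_mul_add_of_contraction (a := fun k ↦ ‖σseq k - σ‖ ^ 2)
    (b := 4 * μ * ((1/2) * ‖Φ σ - Λ‖^2 + (lam * ρ / 2) * ‖σ‖^2 + lam * R σ))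
    hq0 (by positivity) ?_ (fun k ↦ ?_) N
  · field_simp
    ring
  · have hx := hKsub (hmem k)
    have hstep := hprox k
    rw [mul_assoc μ lam ρ] at hstep ⊢
    exact prox_gradient_step hKconv hRconv hR0 hlam.le (by positivity) hμ.le hμs hμβ'
      (hσmem k) hσ (hRIPlow _ hx _ _) (hRIPup _ hx _ _) (hmild _ (hKsub hσ) _ hx) hstep
end

section
/- Let n, m be positive integers, let 0 < c0 < c1, let K01 = [c0,c1]^n, and let K ⊆ K01 be a nonempty compact convex set. Let Φ : ℝⁿ → ℝᵐ be differentiable with Jacobian J_Φ(σ), let R : ℝⁿ → ℝ be nonnegative, convex and continuous, let ρ > 0, C > 0, 0 < δ < 1, and set λ = Cδ. Let Λ ∈ ℝᵐ and σ† ∈ K01 with ‖Λ − Φ(σ†)‖ ≤ δ. Assume the RIP with constants 0 < α ≤ β: α‖σ1 − σ2‖² ≤ ‖J_Φ(σ)(σ1 − σ2)‖² ≤ β‖σ1 − σ2‖² for all σ ∈ K01, σ1, σ2 ∈ ℝⁿ; mild nonlinearity with constant γ > 0: ‖Φ(σ1) − Φ(σ2) − J_Φ(σ2)(σ1 − σ2)‖²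 ≤ γ‖σ1 − σ2‖² for all σ1, σ2 ∈ K01; and α − 2γ > 0. Let σ_K ∈ K be the point of K closest to σ† (the orthogonal projection of σ† onto K), and let Γ1, Γ2 ≥ 0 satisfy ‖σ_K‖² ≤ Γ1 and R(σ_K) ≤ Γ2. Suppose σ̄ ∈ ℝⁿ satisfies the cluster-point bound ‖σ − σ̄‖² ≤ (4/(α + λρ − 2γ)) ((1/2)‖Φ(σ) − Λ‖² + (λρ/2)‖σ‖² + λR(σ)) for all σ ∈ K. Then ‖σ̄ − σ†‖² ≤ ((8 + 4CρΓ1 + 8CΓ2)/(α − 2γ)) · δ + (8β/(α − 2γ) + 2) · ‖σ_K − σ†‖². -/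
/-- A box in Euclidean space is convex. -/
theorem convex_setOf_coord_mem_Icc {ι : Type*} (c0 c1 : ℝ) :
    Convex ℝ {σ : EuclideanSpace ℝ ι | ∀ i, σ i ∈ Set.Icc c0 c1} := by
  intro x hx y hy a b ha hb hab i
  simpa using convex_Icc c0 c1 (hx i) (hy i) ha hb hab

/-- The mean value inequality, with the bound on the derivative and the conclusion in squared
form. -/
theorem Convex.norm_image_sub_sq_le_of_norm_fderiv_sq_le {E F : Type*} [NormedAddCommGroup E]
    [NormedSpace ℝ E] [NormedAddCommGroup F] [NormedSpace ℝ F] {s : Set E} (hs : Convex ℝ s)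
    {f : E → F} {f' : E → E →L[ℝ] F} (hf : ∀ x ∈ s, HasFDerivAt f (f' x) x) {β : ℝ} (hβ : 0 ≤ β)
    (hbound : ∀ x ∈ s, ∀ v, ‖f' x v‖ ^ 2 ≤ β * ‖v‖ ^ 2) {x y : E} (hx : x ∈ s) (hy : y ∈ s) :
    ‖f y - f x‖ ^ 2 ≤ β * ‖y - x‖ ^ 2 := by
  have hop : ∀ z ∈ s, ‖f' z‖ ≤ √β := fun z hz =>
    (f' z).opNorm_le_bound (Real.sqrt_nonneg β) fun v => by
      refine abs_le_of_sq_le_sq' ?_ (by positivity) |>.2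
      rw [mul_pow, Real.sq_sqrt hβ]
      exact hbound z hz v
  have h := hs.norm_image_sub_le_of_norm_hasFDerivWithin_le
    (fun z hz => (hf z hz).hasFDerivWithinAt) hop hx hy
  calc ‖f y - f x‖ ^ 2 ≤ (√β * ‖y - x‖) ^ 2 := by gcongr
    _ = β * ‖y - x‖ ^ 2 := by rw [mul_pow, Real.sq_sqrt hβ]

/-- The squared triangle inequality with constant two. -/
theorem norm_sub_sq_le_two_mul_add {E : Type*} [SeminormedAddCommGroup E] (x y z : E) :
    ‖x - z‖ ^ 2 ≤ 2 * ‖x - y‖ ^ 2 + 2 * ‖y - z‖ ^ 2 := by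
  have h := norm_sub_le_norm_sub_add_norm_sub x y z
  calc ‖x - z‖ ^ 2 ≤ (‖x - y‖ + ‖y - z‖) ^ 2 := by gcongr
    _ ≤ 2 * ‖x - y‖ ^ 2 + 2 * ‖y - z‖ ^ 2 := by
      linarith [sq_nonneg (‖x - y‖ - ‖y - z‖)]

/-- Corollary 4.2 of the paper (the Oracle motivation bound, eq. 31, with explicit
constants, eq. 32): the error of the cluster point is controlled by √δ plus the
distance of the exact solution to the constraint set K. -/
theorem stmt_11 (n m : ℕ) (hn : 0 < n) (hm : 0 < m) (c0 c1 : ℝ) (hc0 : 0 < c0) (hc1 : c0 < c1)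
    (K01 : Set (EuclideanSpace ℝ (Fin n)))
    (hK01 : K01 = {σ : EuclideanSpace ℝ (Fin n) | ∀ i, σ i ∈ Set.Icc c0 c1})
    (K : Set (EuclideanSpace ℝ (Fin n))) (hKcomp : IsCompact K) (hKconv : Convex ℝ K)
    (hKne : K.Nonempty) (hKsub : K ⊆ K01)
    (Φ : EuclideanSpace ℝ (Fin n) → EuclideanSpace ℝ (Fin m))
    (J : EuclideanSpace ℝ (Fin n) → (EuclideanSpace ℝ (Fin n) →L[ℝ] EuclideanSpace ℝ (Fin m)))
    (hJ : ∀ σ, HasFDerivAt Φ (J σ) σ)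
    (R : EuclideanSpace ℝ (Fin n) → ℝ) (hR0 : ∀ σ, 0 ≤ R σ)
    (hRconv : ConvexOn ℝ Set.univ R) (hRcont : Continuous R)
    (ρ C δ lam : ℝ) (hρ : 0 < ρ) (hC : 0 < C) (hδ0 : 0 < δ) (hδ1 : δ < 1)
    (hlam : lam = C * δ)
    (Λ : EuclideanSpace ℝ (Fin m))
    (σd : EuclideanSpace ℝ (Fin n)) (hσd : σd ∈ K01) (hη : ‖Λ - Φ σd‖ ≤ δ)
    -- RIP
    (α β : ℝ) (hα : 0 < α) (hαβ : α ≤ β)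
    (hRIPlow : ∀ σ ∈ K01, ∀ σ1 σ2 : EuclideanSpace ℝ (Fin n),
      α * ‖σ1 - σ2‖^2 ≤ ‖J σ (σ1 - σ2)‖^2)
    (hRIPup : ∀ σ ∈ K01, ∀ σ1 σ2 : EuclideanSpace ℝ (Fin n),
      ‖J σ (σ1 - σ2)‖^2 ≤ β * ‖σ1 - σ2‖^2)
    -- mild nonlinearity
    (γ : ℝ) (hγ : 0 < γ)
    (hmild : ∀ σ1 ∈ K01, ∀ σ2 ∈ K01,
      ‖Φ σ1 - Φ σ2 - J σ2 (σ1 - σ2)‖^2 ≤ γ * ‖σ1 - σ2‖^2)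
    (hαγ : 0 < α - 2 * γ)
    -- the projection of σ† onto K
    (σK : EuclideanSpace ℝ (Fin n)) (hσK : σK ∈ K)
    (hproj : ∀ σ ∈ K, ‖σd - σK‖ ≤ ‖σd - σ‖)
    -- uniform bounds on K₀,₁
    (Γ1 Γ2 : ℝ) (hΓ1 : 0 ≤ Γ1) (hΓ2 : 0 ≤ Γ2)
    (hΓ1bound : ‖σK‖^2 ≤ Γ1) (hΓ2bound : R σK ≤ Γ2)
    -- the cluster-point bound
    (σbar : EuclideanSpace ℝ (Fin n))
    (hcluster : ∀ σ ∈ K,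
      ‖σ - σbar‖^2 ≤ (4 / (α + lam * ρ - 2 * γ)) *
        ((1/2) * ‖Φ σ - Λ‖^2 + (lam * ρ / 2) * ‖σ‖^2 + lam * R σ)) :
    ‖σbar - σd‖^2 ≤
      ((8 + 4 * C * ρ * Γ1 + 8 * C * Γ2) / (α - 2 * γ)) * δ +
        (8 * β / (α - 2 * γ) + 2) * ‖σK - σd‖^2 := by
  have hβ : 0 ≤ β := hα.le.trans hαβ
  have hlam0 : 0 ≤ lam := hlam ▸ (mul_pos hC hδ0).le
  have hconv : Convex ℝ K01 := hK01 ▸ convex_setOf_coord_mem_Icc c0 c1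
  have hLip : ‖Φ σK - Φ σd‖ ^ 2 ≤ β * ‖σK - σd‖ ^ 2 :=
    hconv.norm_image_sub_sq_le_of_norm_fderiv_sq_le (fun σ _ => hJ σ) hβ
      (fun σ hσ v => by simpa using hRIPup σ hσ v 0) hσd (hKsub hσK)
  have hnoise : ‖Φ σd - Λ‖ ^ 2 ≤ δ := by
    rw [norm_sub_rev]
    calc ‖Λ - Φ σd‖ ^ 2 ≤ δ ^ 2 := by gcongr
      _ ≤ δ := by nlinarith
  have hres := norm_sub_sq_le_two_mul_add (Φ σK) (Φ σd) Λ
  have hfun : (1/2) * ‖Φ σK - Λ‖^2 + (lam * ρ / 2) * ‖σK‖^2 + lam * R σK ≤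
      δ + β * ‖σK - σd‖ ^ 2 + (lam * ρ / 2) * Γ1 + lam * Γ2 := by
    have h1 : (lam * ρ / 2) * ‖σK‖^2 ≤ (lam * ρ / 2) * Γ1 := by gcongr
    have h2 : lam * R σK ≤ lam * Γ2 := by gcongr
    linarith
  have hbar : ‖σK - σbar‖ ^ 2 ≤ (4 / (α - 2 * γ)) *
      (δ + β * ‖σK - σd‖ ^ 2 + (lam * ρ / 2) * Γ1 + lam * Γ2) := by
    refine (hcluster σK hσK).trans (mul_le_mul ?_ hfun ?_ (by positivity))
    · gcongr
      linarith [mul_nonneg hlam0 hρ.le]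
    · have := hR0 σK
      positivity
  have htri := norm_sub_sq_le_two_mul_add σbar σK σd
  rw [norm_sub_rev σbar σK] at htri
  calc ‖σbar - σd‖ ^ 2 ≤ 2 * ((4 / (α - 2 * γ)) *
        (δ + β * ‖σK - σd‖ ^ 2 + (lam * ρ / 2) * Γ1 + lam * Γ2)) + 2 * ‖σK - σd‖ ^ 2 := by
        linarith
    _ = _ := by
        rw [hlam]
        ring
end

section
/- Let f : ℝ → ℝ be convex, let y ∈ ℝ, and suppose x* ∈ ℝ is a minimizer of the function h(x) = (1/2)(x − y)² + f(x) over ℝ (it is then the unique minimizer, since h is strictly convex). Let a ≤ b be reals. Then min(max(x*, a), b) is the unique minimizer of h over the interval [a, b]. -/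
theorem strictConvexOn_half_sq_sub (y : ℝ) :
    StrictConvexOn ℝ Set.univ fun x : ℝ => (1/2) * (x - y)^2 := by
  refine ⟨convex_univ, fun u _ v _ huv s t hs ht hst => ?_⟩
  obtain rfl : s = 1 - t := by linarith
  simp only [smul_eq_mul]
  nlinarith [mul_pos (mul_pos hs ht) (sq_pos_of_ne_zero (sub_ne_zero.mpr huv))]

/-- A strictly convex function increases strictly along segments issuing from a minimizer. -/
theorem StrictConvexOn.lt_of_mem_segment_of_isMinOn {E : Type*} [AddCommGroup E] [Module ℝ E]
    {s : Set E} {g : E → ℝ} (hg : StrictConvexOn ℝ s g) {m c x : E} (hm : IsMinOn g s m)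
    (hms : m ∈ s) (hxs : x ∈ s) (hc : c ∈ segment ℝ m x) (hcx : c ≠ x) : g c < g x := by
  have hcs : c ∈ s := hg.1.segment_subset hms hxs hc
  rcases eq_or_ne c m with rfl | hcm
  · refine (hm hxs).lt_of_ne fun h => hcx (hg.eq_of_isMinOn hm ?_ hms hxs)
    exact fun z hz => h.symm.trans_le (hm hz)
  · have hmx : m ≠ x := by
      rintro rfl
      exact hcx (by simpa using hc)
    have hlt := hg.lt_on_openSegment hms hxs hmx
      (mem_openSegment_of_ne_left_right hcm.symm hcx.symm hc)
    exact (lt_max_iff.mp hlt).resolve_left (hm hcs).not_gt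

/-- The clamp of `m` to `[a, b]` lies between `m` and any point of `[a, b]`. -/
theorem clamp_mem_segment {m a b x : ℝ} (hx : x ∈ Set.Icc a b) :
    min (max m a) b ∈ segment ℝ m x := by
  rw [segment_eq_uIcc, Set.mem_uIcc]
  obtain ⟨hax, hxb⟩ := hx
  grind

/-- One-dimensional clamping lemma underlying Proposition 5.1: for convex f, the minimizer
over an interval [a,b] of h(x) = (1/2)(x − y)² + f(x) is the clamp to [a,b] of the
unconstrained minimizer. -/
theorem stmt_14 (f : ℝ → ℝ) (hf : ConvexOn ℝ Set.univ f) (y : ℝ)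
    (xstar : ℝ) (hxstar : ∀ x : ℝ, (1/2) * (xstar - y)^2 + f xstar ≤ (1/2) * (x - y)^2 + f x)
    (a b : ℝ) (hab : a ≤ b) :
    min (max xstar a) b ∈ Set.Icc a b ∧
    (∀ x ∈ Set.Icc a b,
      (1/2) * (min (max xstar a) b - y)^2 + f (min (max xstar a) b) ≤
      (1/2) * (x - y)^2 + f x) ∧
    (∀ x ∈ Set.Icc a b,
      (∀ z ∈ Set.Icc a b, (1/2) * (x - y)^2 + f x ≤ (1/2) * (z - y)^2 + f z) →
      x = min (max xstar a) b) := by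
  have hg : StrictConvexOn ℝ Set.univ fun x : ℝ => (1/2) * (x - y)^2 + f x :=
    (strictConvexOn_half_sq_sub y).add_convexOn hf
  have hmem : min (max xstar a) b ∈ Set.Icc a b :=
    ⟨le_min (le_max_right _ _) hab, min_le_right _ _⟩
  have hlt : ∀ x ∈ Set.Icc a b, min (max xstar a) b ≠ x →
      (1/2) * (min (max xstar a) b - y)^2 + f (min (max xstar a) b) <
      (1/2) * (x - y)^2 + f x := fun x hx hne =>
    hg.lt_of_mem_segment_of_isMinOn (fun z _ => hxstar z) (Set.mem_univ _) (Set.mem_univ _)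
      (clamp_mem_segment hx) hne
  refine ⟨hmem, fun x hx => ?_, fun x hx hmin => ?_⟩
  · rcases eq_or_ne (min (max xstar a) b) x with h | h
    · rw [h]
    · exact (hlt x hx h).le
  · by_contra hne
    exact (hlt x hx (Ne.symm hne)).not_ge (hmin _ hmem)
end

section
/- Let n be a positive integer, t > 0, 0 < c0 < c1, and σ0 ∈ [c0,c1]^n, σ ∈ ℝⁿ. Then the function x ↦ (1/2)‖x − σ‖² + t‖x − σ0‖₁ has a unique minimizer over the box [c0,c1]^n, and it is given componentwise by clamping the unconstrained soft-thresholded value: x*ᵢ = min(max(σ0ᵢ + sign(σᵢ − σ0ᵢ)·max(0, |σᵢ − σ0ᵢ| − t), c0), c1) for i = 1, …, n. Equivalently, the proximal map of g = ‖· − σ0‖₁ + χ_{[c0,c1]^n} is summative: prox_{t g} = proj_{[c0,c1]^n} ∘ prox_{t‖·−σ0‖₁}. -/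
/-- The clamp to `[c0, c1]` of the soft-thresholding of `s` around `a ∈ [c0, c1]` satisfies the
variational inequality of the minimization of `(x - s) ^ 2 / 2 + t * |x - a|` over `[c0, c1]`. -/
lemma clamp_softThreshold_variational {t c0 c1 a s x : ℝ} (ht : 0 < t)
    (ha : a ∈ Set.Icc c0 c1) (hx : x ∈ Set.Icc c0 c1) {p : ℝ}
    (hp : p = min (max (a + Real.sign (s - a) * max 0 (|s - a| - t)) c0) c1) :
    0 ≤ (x - p) * (p - s) + t * (|x - a| - |p - a|) := by
  obtain ⟨ha0, ha1⟩ := ha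
  obtain ⟨hx0, hx1⟩ := hx
  rcases le_or_gt |s - a| t with h | h
  · have hpa : p = a := by
      rw [hp, max_eq_left (by linarith : |s - a| - t ≤ 0), mul_zero, add_zero,
        max_eq_left ha0, min_eq_left ha1]
    subst hpa
    have h1 : |(x - p) * (s - p)| ≤ |x - p| * t := by
      rw [abs_mul]
      gcongr
    have h2 := le_abs_self ((x - p) * (s - p))
    rw [sub_self, abs_zero]
    linarith
  · rcases lt_abs.1 h with h' | h'
    · have hs : 0 < s - a := ht.trans h'
      have hpe : p = min (s - t) c1 := by
        rw [hp, Real.sign_of_pos hs, abs_of_pos hs,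
          max_eq_right (by linarith : 0 ≤ s - a - t), max_eq_left (by linarith)]
        congr 1
        ring
      have hap : a ≤ p := hpe ▸ le_min (by linarith) ha1
      have hxa := mul_le_mul_of_nonneg_left (le_abs_self (x - a)) ht.le
      rw [abs_of_nonneg (sub_nonneg.2 hap)]
      rcases min_cases (s - t) c1 with ⟨hm, _⟩ | ⟨hm, hlt⟩ <;> rw [hm] at hpe <;> subst hpe
      · linarith
      · nlinarith [mul_nonneg (sub_nonneg.2 hx1) (by linarith : 0 ≤ s - t - p)]
    · have hs : s - a < 0 := by linarith
      have hpe : p = max (s + t) c0 := by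
        rw [hp, Real.sign_of_neg hs, abs_of_neg hs,
          max_eq_right (by linarith : 0 ≤ -(s - a) - t),
          min_eq_left (max_le (by linarith) (ha0.trans ha1))]
        congr 1
        ring
      have hap : p ≤ a := hpe ▸ max_le (by linarith) ha0
      have hxa := mul_le_mul_of_nonneg_left (neg_le_abs (x - a)) ht.le
      rw [abs_of_nonpos (sub_nonpos.2 hap)]
      rcases max_cases (s + t) c0 with ⟨hm, _⟩ | ⟨hm, hlt⟩ <;> rw [hm] at hpe <;> subst hpe
      · linarith
      · nlinarith [mul_nonneg (sub_nonneg.2 hx0) (by linarith : 0 ≤ p - (s + t))]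

/-- Proposition 5.1 of the paper for R = ‖· − σ0‖₁ and the box constraint K = [c0,c1]ⁿ:
the proximal map of g = ‖· − σ0‖₁ + χ_K is summative, i.e. the unique minimizer over the
box is the componentwise clamp of the soft-thresholded unconstrained minimizer. -/
theorem stmt_15 (n : ℕ) (hn : 0 < n) (t : ℝ) (ht : 0 < t)
    (c0 c1 : ℝ) (hc0 : 0 < c0) (hc1 : c0 < c1)
    (σ0 σ : EuclideanSpace ℝ (Fin n)) (hσ0 : ∀ i, σ0 i ∈ Set.Icc c0 c1) :
    ∃ xstar : EuclideanSpace ℝ (Fin n),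
      (∀ i : Fin n,
        xstar i =
          min (max (σ0 i + Real.sign (σ i - σ0 i) * max 0 (|σ i - σ0 i| - t)) c0) c1) ∧
      (∀ i : Fin n, xstar i ∈ Set.Icc c0 c1) ∧
      (∀ x : EuclideanSpace ℝ (Fin n), (∀ i, x i ∈ Set.Icc c0 c1) →
        (1/2) * ‖xstar - σ‖^2 + t * (∑ i, |xstar i - σ0 i|) ≤
        (1/2) * ‖x - σ‖^2 + t * (∑ i, |x i - σ0 i|)) ∧
      (∀ x : EuclideanSpace ℝ (Fin n), (∀ i, x i ∈ Set.Icc c0 c1) →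
        (∀ y : EuclideanSpace ℝ (Fin n), (∀ i, y i ∈ Set.Icc c0 c1) →
          (1/2) * ‖x - σ‖^2 + t * (∑ i, |x i - σ0 i|) ≤
          (1/2) * ‖y - σ‖^2 + t * (∑ i, |y i - σ0 i|)) → x = xstar) := by
  obtain ⟨p, hp⟩ : ∃ p : EuclideanSpace ℝ (Fin n), ∀ i, p i =
      min (max (σ0 i + Real.sign (σ i - σ0 i) * max 0 (|σ i - σ0 i| - t)) c0) c1 :=
    ⟨WithLp.toLp 2 fun i =>
      min (max (σ0 i + Real.sign (σ i - σ0 i) * max 0 (|σ i - σ0 i| - t)) c0) c1, fun _ => rfl⟩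
  have hmem : ∀ i, p i ∈ Set.Icc c0 c1 := fun i => by
    rw [hp i]
    exact ⟨le_min (le_max_right _ _) hc1.le, min_le_right _ _⟩
  have growth : ∀ x : EuclideanSpace ℝ (Fin n), (∀ i, x i ∈ Set.Icc c0 c1) →
      (1/2) * ‖p - σ‖^2 + t * (∑ i, |p i - σ0 i|) + (1/2) * ‖x - p‖^2 ≤
      (1/2) * ‖x - σ‖^2 + t * (∑ i, |x i - σ0 i|) := fun x hx => by
    simp only [EuclideanSpace.real_norm_sq_eq, PiLp.sub_apply, Finset.mul_sum,
      ← Finset.sum_add_distrib]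
    refine Finset.sum_le_sum fun i _ => ?_
    linarith [clamp_softThreshold_variational ht (hσ0 i) (hx i) (hp i)]
  refine ⟨p, hp, hmem, fun x hx => ?_, fun x hx hmin => ?_⟩
  · linarith [growth x hx, sq_nonneg ‖x - p‖]
  · have hsq : ‖x - p‖^2 = 0 := by
      linarith [growth x hx, hmin p hmem, sq_nonneg ‖x - p‖]
    exact sub_eq_zero.1 (norm_eq_zero.1 (pow_eq_zero_iff two_ne_zero |>.1 hsq))
end
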